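/- Let Q, E₁, E₂ be continuous 2×2 matrix-valued functions on [0,b] with E₁ anti-commuting and E₂ commuting pointwise with B = [[0,1],[-1,0]]. Then any continuous solution H of the integral equation H(ξ,η) = -(1/2)BE₁(ξ) - (1/2)BE₂(η) + ∫₀^ξ BQ(u+η)P⁺[H(u,η)]du + ∫₀^η BQ(ξ+v)P⁻[H(ξ,v)]dv on the triangle {ξ,η ≥ 0, ξ+η ≤ b} satisfies |H(ξ,η)| ≤ ((sup|E₁| + sup|E₂|)/2)·exp(b·sup|Q|). -/

import Mathlib

open Matrix Set intervalIntegral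

noncomputable section

attribute [local instance] Matrix.frobeniusNormedAddCommGroup Matrix.frobeniusNormedSpace

/-- The matrix B = [[0,1],[-1,0]]. -/
def Bmat : Matrix (Fin 2) (Fin 2) ℂ := !![0, 1; -1, 0]

/-- P⁻[A] = (A - BAB)/2. -/
def Pminus (A : Matrix (Fin 2) (Fin 2) ℂ) : Matrix (Fin 2) (Fin 2) ℂ :=
  (2⁻¹ : ℂ) • (A - Bmat * A * Bmat)

/-- P⁺[A] = (A + BAB)/2. -/
def Pplus (A : Matrix (Fin 2) (Fin 2) ℂ) : Matrix (Fin 2) (Fin 2) ℂ :=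
  (2⁻¹ : ℂ) • (A + Bmat * A * Bmat)

/-- The triangle {(ξ,η) : ξ, η ≥ 0, ξ + η ≤ b}. -/
def Xi (b : ℝ) : Set (ℝ × ℝ) := {p | 0 ≤ p.1 ∧ 0 ≤ p.2 ∧ p.1 + p.2 ≤ b}

lemma frob_mono {α β : Type*} [NormedAddCommGroup α] [NormedAddCommGroup β]
    (A : Matrix (Fin 2) (Fin 2) α) (B : Matrix (Fin 2) (Fin 2) β)
    (h : ∀ i j, ‖A i j‖ ≤ ‖B i j‖) : ‖A‖ ≤ ‖B‖ := by
  rw [Matrix.frobenius_norm_def, Matrix.frobenius_norm_def]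
  gcongr with i _ j _
  exact h i j

lemma frob_sq {α : Type*} [NormedAddCommGroup α] (A : Matrix (Fin 2) (Fin 2) α) :
    ‖A‖ ^ 2 = ‖A 0 0‖ ^ 2 + ‖A 0 1‖ ^ 2 + ‖A 1 0‖ ^ 2 + ‖A 1 1‖ ^ 2 := by
  rw [Matrix.frobenius_norm_def, ← Real.sqrt_eq_rpow, Real.sq_sqrt (by positivity)]
  simp [Fin.sum_univ_two]
  ring

lemma entry_le {α : Type*} [NormedAddCommGroup α] (A : Matrix (Fin 2) (Fin 2) α) (i j : Fin 2) :
    ‖A i j‖ ≤ ‖A‖ := by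
  refine abs_le_of_sq_le_sq' ?_ (norm_nonneg _) |>.2
  rw [frob_sq]
  fin_cases i <;> fin_cases j <;> simp <;> nlinarith [sq_nonneg ‖A 0 0‖, sq_nonneg ‖A 0 1‖,
    sq_nonneg ‖A 1 0‖, sq_nonneg ‖A 1 1‖]

lemma gron (b q K : ℝ) (p : ℝ → ℝ) (hq : 0 ≤ q) (hp : Continuous p)
    (h : ∀ s ∈ Icc 0 b, p s ≤ ∫ t in (0 : ℝ)..s, q * (K + p t)) :
    ∀ s ∈ Icc 0 b, p s + K ≤ K * Real.exp (q * s) := by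
  intro s hs
  set w : ℝ → ℝ := fun s => ∫ t in (0 : ℝ)..s, q * (K + p t) with hw
  have hd : ∀ x, HasDerivAt w (q * (K + p x)) x := fun x =>
    (Continuous.integral_hasStrictDerivAt (by fun_prop) 0 x).hasDerivAt
  have hg : ∀ x, HasDerivAt (fun x => (w x + K) * Real.exp (-(q * x)))
      ((q * (K + p x)) * Real.exp (-(q * x)) + (w x + K) * (Real.exp (-(q * x)) * (-(q * 1)))) x := by
    intro x
    exact ((hd x).add_const K).mul (((hasDerivAt_id x).const_mul q).neg.exp)
  have hanti : AntitoneOn (fun x => (w x + K) * Real.exp (-(q * x))) (Icc 0 b) := by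
    apply antitoneOn_of_deriv_nonpos (convex_Icc 0 b)
    · exact fun x _ => (hg x).continuousAt.continuousWithinAt
    · exact fun x _ => (hg x).differentiableAt.differentiableWithinAt
    · intro x hx
      rw [interior_Icc] at hx
      rw [(hg x).deriv]
      have h1 := h x ⟨hx.1.le, hx.2.le⟩
      have h2 : q * (K + p x) - q * (w x + K) ≤ 0 := by
        have := mul_le_mul_of_nonneg_left h1 hq
        simp only [hw]; linarith
      have h3 := mul_nonpos_of_nonpos_of_nonneg h2 (Real.exp_pos (-(q * x))).le
      linarith
  have h4 := hanti ⟨le_rfl, hs.1.trans hs.2⟩ hs hs.1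
  have h5 : w 0 = 0 := by simp [hw]
  simp only [h5, mul_zero, neg_zero, Real.exp_zero, zero_add, mul_one] at h4
  rw [Real.exp_neg, ← div_eq_mul_inv, div_le_iff₀ (Real.exp_pos _)] at h4
  have := h s hs
  simp only [hw] at h4
  linarith

lemma sum_two (j : Fin 2) (x : Fin 2 → ℝ) : ∑ k, x k = x j + x (1 - j) := by
  fin_cases j <;> simp [Fin.sum_univ_two, add_comm]

lemma swap_norm (A : Matrix (Fin 2) (Fin 2) ℝ) (G F : ℝ) (hG : 0 ≤ G) (hF : 0 ≤ F) :
    ‖A * !![G, F; F, G]‖ ≤ ‖A‖ * (F + G) := by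
  have h1 : A * !![G, F; F, G] = G • A + F • !![A 0 1, A 0 0; A 1 1, A 1 0] := by
    ext i j
    fin_cases i <;> fin_cases j <;> simp [Matrix.mul_apply, Fin.sum_univ_two] <;> ring
  have h2 : ‖!![A 0 1, A 0 0; A 1 1, A 1 0]‖ = ‖A‖ := by
    rw [← sq_eq_sq₀ (norm_nonneg _) (norm_nonneg _), frob_sq, frob_sq]
    simp; ring
  rw [h1]
  refine (norm_add_le _ _).trans ?_
  rw [norm_smul, norm_smul, h2, Real.norm_of_nonneg hG, Real.norm_of_nonneg hF]
  linarith

lemma core (b : ℝ) (hb : 0 ≤ b) (R f g : ℝ → Matrix (Fin 2) (Fin 2) ℂ) (q F G : ℝ)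
    (hR : ContinuousOn R (Icc 0 b))
    (hRq : ∀ x ∈ Icc 0 b, ‖R x‖ ≤ q) (hfF : ∀ x ∈ Icc 0 b, ‖f x‖ ≤ F)
    (hgG : ∀ x ∈ Icc 0 b, ‖g x‖ ≤ G)
    (hf : ∀ x j, f x j j = 0) (hg : ∀ x i j, i ≠ j → g x i j = 0)
    (h : ℝ → ℝ → Matrix (Fin 2) (Fin 2) ℂ)
    (hc : ContinuousOn (fun p : ℝ × ℝ => h p.1 p.2) (Xi b))
    (heq : ∀ ξ η : ℝ, (ξ, η) ∈ Xi b → ∀ i j, h ξ η i j = f ξ i j + g η i j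
        + (∫ u in (0 : ℝ)..ξ, R (u + η) i (1 - j) * h u η (1 - j) j)
        + (∫ v in (0 : ℝ)..η, R (ξ + v) i j * h ξ v j j)) :
    ∀ ξ η : ℝ, (ξ, η) ∈ Xi b → ‖h ξ η‖ ≤ (F + G) * Real.exp (q * b) := by
  have h0 : (0 : ℝ) ∈ Icc 0 b := ⟨le_rfl, hb⟩
  have hF0 : 0 ≤ F := (norm_nonneg _).trans (hfF 0 h0)
  have hG0 : 0 ≤ G := (norm_nonneg _).trans (hgG 0 h0)
  have hq0 : 0 ≤ q := (norm_nonneg _).trans (hRq 0 h0)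
  -- projection onto the interval
  let pr : ℝ → ℝ := fun t => max 0 (min t b)
  have prc : Continuous pr := by fun_prop
  have prm : ∀ t, pr t ∈ Icc 0 b := fun t => ⟨le_max_left _ _, max_le hb (min_le_right _ _)⟩
  have pre : ∀ t ∈ Icc 0 b, pr t = t := fun t ht => by
    simp only [pr]; rw [min_eq_left ht.2, max_eq_right ht.1]
  let pu : ℝ → ℝ := fun t => max 0 (min t 1)
  have puc : Continuous pu := by fun_prop
  have pum : ∀ t, pu t ∈ Icc 0 1 := fun t => ⟨le_max_left _ _, max_le (by norm_num) (min_le_right _ _)⟩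
  have pue : ∀ t ∈ Icc (0 : ℝ) 1, pu t = t := fun t ht => by
    simp only [pu]; rw [min_eq_left ht.2, max_eq_right ht.1]
  let A : ℝ → Matrix (Fin 2) (Fin 2) ℝ := fun t => Matrix.of fun i j => ‖R (pr t) i j‖
  have hA0 : ∀ t i j, 0 ≤ A t i j := fun t i j => norm_nonneg (R (pr t) i j)
  have hRc : Continuous fun t => R (pr t) := hR.comp_continuous prc prm
  have hAc : ∀ i j, Continuous fun t => A t i j := fun i j => (hRc.matrix_elem i j).norm
  have hAq : ∀ t, ‖A t‖ ≤ q := fun t =>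
    (frob_mono _ (R (pr t)) (fun i j => by simp [A])).trans (hRq _ (prm t))
  let hh : Fin 2 → Fin 2 → ℝ → ℝ → ℝ := fun i j s τ =>
    ‖h (pu τ * pr s) ((1 - pu τ) * pr s) i j‖
  have hmem : ∀ s τ, ((pu τ * pr s, (1 - pu τ) * pr s) : ℝ × ℝ) ∈ Xi b := by
    intro s τ
    have h1 := pum τ
    have h2 := prm s
    refine ⟨mul_nonneg h1.1 h2.1, mul_nonneg (by linarith [h1.2]) h2.1, ?_⟩
    have : pu τ * pr s + (1 - pu τ) * pr s = pr s := by ring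
    simpa only [this] using h2.2
  have hhc : ∀ i j, Continuous (Function.uncurry (hh i j)) := by
    intro i j
    have : Continuous fun p : ℝ × ℝ => h (pu p.2 * pr p.1) ((1 - pu p.2) * pr p.1) :=
      hc.comp_continuous (f := fun p : ℝ × ℝ => ((pu p.2 * pr p.1, (1 - pu p.2) * pr p.1) : ℝ × ℝ))
        (by fun_prop) (fun p => hmem p.1 p.2)
    exact (this.matrix_elem i j).norm
  let φ : ℝ → Matrix (Fin 2) (Fin 2) ℝ := fun s => Matrix.of fun i j =>
    sSup (hh i j s '' Icc 0 1)
  have hφc : ∀ i j, Continuous fun s => φ s i j := fun i j =>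
    isCompact_Icc.continuous_sSup (hhc i j)
  have hφ0 : ∀ s i j, 0 ≤ φ s i j := by
    intro s i j
    apply Real.sSup_nonneg
    rintro _ ⟨τ, -, rfl⟩
    exact norm_nonneg _
  have hle : ∀ ξ η, (ξ, η) ∈ Xi b → ∀ i j, ‖h ξ η i j‖ ≤ φ (ξ + η) i j := by
    intro ξ η hm i j
    obtain ⟨h1, h2, h3⟩ := hm
    simp only at h1 h2 h3
    have hs : pr (ξ + η) = ξ + η := pre _ ⟨by linarith, h3⟩
    have hbdd : BddAbove (hh i j (ξ + η) '' Icc 0 1) :=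
      (isCompact_Icc.image ((hhc i j).comp (by fun_prop : Continuous fun τ : ℝ => (ξ + η, τ)))).bddAbove
    rcases (add_nonneg h1 h2).eq_or_lt with h4 | h4
    · have e1 : ξ = 0 := by linarith
      have e2 : η = 0 := by linarith
      apply le_csSup hbdd
      refine ⟨0, ⟨le_rfl, zero_le_one⟩, ?_⟩
      simp only [hh, hs]
      subst e1 e2
      simp
    · apply le_csSup hbdd
      have hτ : ξ / (ξ + η) ∈ Icc (0 : ℝ) 1 :=
        ⟨by positivity, by rw [div_le_one h4]; linarith⟩
      refine ⟨ξ / (ξ + η), hτ, ?_⟩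
      simp only [hh, hs, pue _ hτ]
      have e1 : ξ / (ξ + η) * (ξ + η) = ξ := by field_simp
      have e2 : (1 - ξ / (ξ + η)) * (ξ + η) = η := by field_simp; ring
      rw [e1, e2]
  let ψ : ℝ → Matrix (Fin 2) (Fin 2) ℝ := fun s => ∫ t in (0 : ℝ)..s, A t * φ t
  have hAφc : Continuous fun t => A t * φ t := by
    apply continuous_matrix
    intro i j
    simp only [Matrix.mul_apply]
    exact continuous_finsetSum _ fun k _ => (hAc i k).mul (hφc k j)
  have hψc : Continuous ψ := intervalIntegral.continuous_primitive
    (fun _ _ => hAφc.intervalIntegrable _ _) 0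
  have hψe : ∀ s i j, ψ s i j = ∫ t in (0 : ℝ)..s, ∑ k, A t i k * φ t k j := by
    intro s i j
    let L : Matrix (Fin 2) (Fin 2) ℝ →L[ℝ] ℝ :=
      LinearMap.toContinuousLinearMap (Matrix.entryLinearMap ℝ ℝ i j)
    have := L.intervalIntegral_comp_comm
      (hAφc.intervalIntegrable (μ := MeasureTheory.volume) 0 s)
    simp only [← Matrix.mul_apply]
    exact this.symm
  -- entrywise bound
  have hkey : ∀ ξ η, (ξ, η) ∈ Xi b → ∀ i j,
      ‖h ξ η i j‖ ≤ ‖f ξ i j + g η i j‖ + ψ (ξ + η) i j := by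
    intro ξ η hm i j
    obtain ⟨h1, h2, h3⟩ := id hm
    simp only at h1 h2 h3
    rw [heq ξ η hm i j, hψe]
    have c1 : ∀ k, Continuous fun t => A t i k * φ t k j := fun k => (hAc i k).mul (hφc k j)
    have n1 : ∀ k t, 0 ≤ A t i k * φ t k j := fun k t => mul_nonneg (hA0 _ _ _) (hφ0 _ _ _)
    have I1 : ‖∫ u in (0 : ℝ)..ξ, R (u + η) i (1 - j) * h u η (1 - j) j‖
        ≤ ∫ t in (0 : ℝ)..(ξ + η), A t i (1 - j) * φ t (1 - j) j := by
      calc _ ≤ ∫ u in (0 : ℝ)..ξ, A (u + η) i (1 - j) * φ (u + η) (1 - j) j := by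
            apply intervalIntegral.norm_integral_le_of_norm_le h1
            · refine Filter.Eventually.of_forall fun u hu => ?_
              rw [norm_mul]
              have e : pr (u + η) = u + η := pre _ ⟨by linarith [hu.1], by linarith [hu.2]⟩
              have e1 : A (u + η) i (1 - j) = ‖R (u + η) i (1 - j)‖ := by simp [A, e]
              rw [e1]
              exact mul_le_mul_of_nonneg_left
                (hle _ _ ⟨hu.1.le, h2, by simp only; linarith [hu.2]⟩ _ _) (norm_nonneg _)
            · exact ((c1 (1 - j)).comp (continuous_add_const η)).intervalIntegrable _ _
        _ = ∫ t in η..(ξ + η), A t i (1 - j) * φ t (1 - j) j := by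
            rw [intervalIntegral.integral_comp_add_right
              (fun t => A t i (1 - j) * φ t (1 - j) j), zero_add]
        _ ≤ _ := intervalIntegral.integral_mono_interval h2 (by linarith) le_rfl
            (Filter.Eventually.of_forall (n1 _)) ((c1 _).intervalIntegrable _ _)
    have I2 : ‖∫ v in (0 : ℝ)..η, R (ξ + v) i j * h ξ v j j‖
        ≤ ∫ t in (0 : ℝ)..(ξ + η), A t i j * φ t j j := by
      calc _ ≤ ∫ v in (0 : ℝ)..η, A (ξ + v) i j * φ (ξ + v) j j := by
            apply intervalIntegral.norm_integral_le_of_norm_le h2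
            · refine Filter.Eventually.of_forall fun u hu => ?_
              rw [norm_mul]
              have e : pr (ξ + u) = ξ + u := pre _ ⟨by linarith [hu.1], by linarith [hu.2]⟩
              have e1 : A (ξ + u) i j = ‖R (ξ + u) i j‖ := by simp [A, e]
              rw [e1]
              exact mul_le_mul_of_nonneg_left
                (hle _ _ ⟨h1, hu.1.le, by simp only; linarith [hu.2]⟩ _ _) (norm_nonneg _)
            · exact ((c1 j).comp (continuous_const_add ξ)).intervalIntegrable _ _
        _ = ∫ t in ξ..(ξ + η), A t i j * φ t j j := by
            rw [intervalIntegral.integral_comp_add_left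
              (fun t => A t i j * φ t j j), add_zero]
        _ ≤ _ := intervalIntegral.integral_mono_interval h1 (by linarith) le_rfl
            (Filter.Eventually.of_forall (n1 _)) ((c1 _).intervalIntegrable _ _)
    simp only [sum_two j]
    rw [intervalIntegral.integral_add ((c1 _).intervalIntegrable _ _)
      ((c1 _).intervalIntegrable _ _)]
    have t1 := norm_add_le (f ξ i j + g η i j
        + (∫ u in (0 : ℝ)..ξ, R (u + η) i (1 - j) * h u η (1 - j) j))
        (∫ v in (0 : ℝ)..η, R (ξ + v) i j * h ξ v j j)
    have t2 := norm_add_le (f ξ i j + g η i j)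
        (∫ u in (0 : ℝ)..ξ, R (u + η) i (1 - j) * h u η (1 - j) j)
    linarith
  let C : Matrix (Fin 2) (Fin 2) ℝ := !![G, F; F, G]
  have hfg : ∀ ξ ∈ Icc 0 b, ∀ η ∈ Icc 0 b, ∀ i j, ‖f ξ i j + g η i j‖ ≤ C i j := by
    intro ξ hξ η hη i j
    have hf1 := (entry_le (f ξ) i j).trans (hfF ξ hξ)
    have hg1 := (entry_le (g η) i j).trans (hgG η hη)
    by_cases hij : i = j
    · subst hij
      rw [hf, zero_add]
      refine hg1.trans (le_of_eq ?_)
      fin_cases i <;> simp [C]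
    · rw [hg _ _ _ hij, add_zero]
      refine hf1.trans (le_of_eq ?_)
      fin_cases i <;> fin_cases j <;> simp_all [C]
  have hφψ : ∀ s ∈ Icc 0 b, ∀ i j, φ s i j ≤ C i j + ψ s i j := by
    intro s hs i j
    apply csSup_le ((nonempty_Icc.2 zero_le_one).image _)
    rintro _ ⟨τ, -, rfl⟩
    have hm := hmem s τ
    have e : pu τ * pr s + (1 - pu τ) * pr s = s := by rw [pre s hs]; ring
    have h1 := hkey _ _ hm i j
    rw [e] at h1
    obtain ⟨h2, h3, h4⟩ := hm
    simp only at h2 h3 h4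
    have h5 := hfg (pu τ * pr s) ⟨h2, by linarith⟩ ((1 - pu τ) * pr s) ⟨h3, by linarith⟩ i j
    simp only [hh]
    linarith
  have hnorm : ∀ t ∈ Icc 0 b, ‖A t * φ t‖ ≤ q * ((F + G) + ‖ψ t‖) := by
    intro t ht
    have h1 : ‖A t * φ t‖ ≤ ‖A t * (C + ψ t)‖ := by
      apply frob_mono
      intro i j
      have h2 : 0 ≤ (A t * φ t) i j := by
        rw [Matrix.mul_apply]
        exact Finset.sum_nonneg fun k _ => mul_nonneg (hA0 _ _ _) (hφ0 _ _ _)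
      have h3 : (A t * φ t) i j ≤ (A t * (C + ψ t)) i j := by
        rw [Matrix.mul_apply, Matrix.mul_apply]
        exact Finset.sum_le_sum fun k _ => mul_le_mul_of_nonneg_left (hφψ t ht k j) (hA0 _ _ _)
      rw [Real.norm_of_nonneg h2, Real.norm_of_nonneg (h2.trans h3)]
      exact h3
    have h4 : ‖A t * (C + ψ t)‖ ≤ ‖A t‖ * (F + G) + ‖A t‖ * ‖ψ t‖ := by
      rw [Matrix.mul_add]
      exact (norm_add_le _ _).trans
        (add_le_add (swap_norm _ _ _ hG0 hF0) (Matrix.frobenius_norm_mul _ _))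
    calc _ ≤ ‖A t‖ * ((F + G) + ‖ψ t‖) := by linarith
      _ ≤ _ := mul_le_mul_of_nonneg_right (hAq t) (by positivity)
  have hgr := gron b q (F + G) (fun s => ‖ψ s‖) hq0 hψc.norm (by
    intro s hs
    apply intervalIntegral.norm_integral_le_of_norm_le hs.1
    · exact Filter.Eventually.of_forall fun t ht => hnorm t ⟨ht.1.le, ht.2.trans hs.2⟩
    · exact Continuous.intervalIntegrable (by fun_prop) _ _)
  intro ξ η hm
  obtain ⟨h1, h2, h3⟩ := id hm
  simp only at h1 h2 h3
  let N : Matrix (Fin 2) (Fin 2) ℝ := Matrix.of fun i j => ‖f ξ i j + g η i j‖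
  have hN : ‖N‖ ≤ F + G := by
    calc ‖N‖ ≤ ‖f ξ + g η‖ := frob_mono _ _ (fun i j => by simp [N])
      _ ≤ _ := (norm_add_le _ _).trans
        (add_le_add (hfF _ ⟨h1, by linarith⟩) (hgG _ ⟨h2, by linarith⟩))
  have hfin : ‖h ξ η‖ ≤ ‖N + ψ (ξ + η)‖ := by
    apply frob_mono
    intro i j
    exact (hkey ξ η hm i j).trans (le_abs_self _)
  have h6 := hgr (ξ + η) ⟨by linarith, h3⟩
  have h7 := norm_add_le N (ψ (ξ + η))
  have h8 : (F + G) * Real.exp (q * (ξ + η)) ≤ (F + G) * Real.exp (q * b) := by gcongr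
  linarith

def Vm : Matrix (Fin 2) (Fin 2) ℂ := !![1, 1; Complex.I, -Complex.I]
def Wm : Matrix (Fin 2) (Fin 2) ℂ := !![2⁻¹, -(Complex.I / 2); 2⁻¹, Complex.I / 2]

lemma W_mul_V : Wm * Vm = 1 := by
  ext i j
  fin_cases i <;> fin_cases j <;>
    simp [Wm, Vm, Matrix.mul_apply, Fin.sum_univ_two] <;> ring_nf <;> simp <;> norm_num

lemma V_mul_W : Vm * Wm = 1 := mul_eq_one_comm.1 W_mul_V

lemma conj_entries (A : Matrix (Fin 2) (Fin 2) ℂ) :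
    Wm * A * Vm = !![(A 0 0 + A 1 1 + Complex.I * (A 0 1 - A 1 0)) / 2,
        (A 0 0 - A 1 1 - Complex.I * (A 0 1 + A 1 0)) / 2;
      (A 0 0 - A 1 1 + Complex.I * (A 0 1 + A 1 0)) / 2,
        (A 0 0 + A 1 1 - Complex.I * (A 0 1 - A 1 0)) / 2] := by
  ext i j
  fin_cases i <;> fin_cases j <;>
    simp only [Wm, Vm, Matrix.mul_apply, Fin.sum_univ_two] <;> simp <;> ring_nf <;> simp <;> ring

lemma conj_norm (A : Matrix (Fin 2) (Fin 2) ℂ) : ‖Wm * A * Vm‖ = ‖A‖ := by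
  rw [← sq_eq_sq₀ (norm_nonneg _) (norm_nonneg _), frob_sq, frob_sq, conj_entries]
  simp only [← Complex.normSq_eq_norm_sq, Complex.normSq_apply]
  simp
  ring

lemma B_norm (A : Matrix (Fin 2) (Fin 2) ℂ) : ‖Bmat * A‖ = ‖A‖ := by
  rw [← sq_eq_sq₀ (norm_nonneg _) (norm_nonneg _), frob_sq, frob_sq]
  simp [Bmat, Matrix.mul_apply, Fin.sum_univ_two]
  ring

lemma conj_Pplus (A : Matrix (Fin 2) (Fin 2) ℂ) (k j : Fin 2) :
    (Wm * Pplus A * Vm) k j = if k = j then 0 else (Wm * A * Vm) k j := by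
  rw [conj_entries, conj_entries]
  fin_cases k <;> fin_cases j <;>
    simp only [Pplus, Bmat, Matrix.smul_apply, Matrix.add_apply, Matrix.sub_apply, Matrix.mul_apply,
      Fin.sum_univ_two] <;> simp <;> ring

lemma conj_Pminus (A : Matrix (Fin 2) (Fin 2) ℂ) (k j : Fin 2) :
    (Wm * Pminus A * Vm) k j = if k = j then (Wm * A * Vm) k j else 0 := by
  rw [conj_entries, conj_entries]
  fin_cases k <;> fin_cases j <;>
    simp only [Pminus, Bmat, Matrix.smul_apply, Matrix.add_apply, Matrix.sub_apply, Matrix.mul_apply,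
      Fin.sum_univ_two] <;> simp <;> ring

lemma Bsq : Bmat * Bmat = -1 := by
  ext i j
  fin_cases i <;> fin_cases j <;> simp [Bmat, Matrix.mul_apply, Fin.sum_univ_two]

lemma sum_twoC (j : Fin 2) (x : Fin 2 → ℂ) : ∑ k, x k = x j + x (1 - j) := by
  fin_cases j <;> simp [Fin.sum_univ_two, add_comm]

lemma ne_sub (j : Fin 2) : 1 - j ≠ j := by
  fin_cases j <;> simp

lemma conjug_mul (X Y : Matrix (Fin 2) (Fin 2) ℂ) :
    Wm * (X * Y) * Vm = (Wm * X * Vm) * (Wm * Y * Vm) := by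
  calc Wm * (X * Y) * Vm = Wm * X * (1 : Matrix (Fin 2) (Fin 2) ℂ) * Y * Vm := by
        simp only [Matrix.mul_assoc, Matrix.one_mul]
    _ = _ := by rw [← V_mul_W]; simp only [Matrix.mul_assoc]

lemma le_sup_Icc (b : ℝ) (E : ℝ → Matrix (Fin 2) (Fin 2) ℂ) (hE : ContinuousOn E (Icc 0 b)) :
    ∀ x ∈ Icc 0 b, ‖E x‖ ≤ ⨆ x : Icc 0 b, ‖E x‖ := by
  intro x hx
  have hbd : BddAbove (Set.range fun x : Icc 0 b => ‖E x‖) := by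
    have := (isCompact_Icc.image_of_continuousOn hE.norm).bddAbove
    rwa [image_eq_range] at this
  exact le_ciSup hbd ⟨x, hx⟩

theorem stmt_16 (b : ℝ) (hb : 0 ≤ b) (Q E₁ E₂ : ℝ → Matrix (Fin 2) (Fin 2) ℂ)
    (hQ : ContinuousOn Q (Icc 0 b)) (hE₁ : ContinuousOn E₁ (Icc 0 b))
    (hE₂ : ContinuousOn E₂ (Icc 0 b))
    (hE₁anti : ∀ x : ℝ, E₁ x * Bmat = -(Bmat * E₁ x))
    (hE₂comm : ∀ x : ℝ, E₂ x * Bmat = Bmat * E₂ x)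
    (H : ℝ → ℝ → Matrix (Fin 2) (Fin 2) ℂ)
    (hHc : ContinuousOn (fun p : ℝ × ℝ => H p.1 p.2) (Xi b))
    (hHeq : ∀ ξ η : ℝ, (ξ, η) ∈ Xi b →
      H ξ η = -((2⁻¹ : ℂ) • (Bmat * E₁ ξ)) - (2⁻¹ : ℂ) • (Bmat * E₂ η)
        + (∫ u in (0 : ℝ)..ξ, Bmat * Q (u + η) * Pplus (H u η))
        + (∫ v in (0 : ℝ)..η, Bmat * Q (ξ + v) * Pminus (H ξ v))) :
    ∀ ξ η : ℝ, (ξ, η) ∈ Xi b →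
      ‖H ξ η‖ ≤ ((⨆ x : Icc 0 b, ‖E₁ x‖) + (⨆ x : Icc 0 b, ‖E₂ x‖)) / 2 *
        Real.exp (b * ⨆ x : Icc 0 b, ‖Q x‖) := by
  have hcW : ∀ i j, Continuous fun A : Matrix (Fin 2) (Fin 2) ℂ => (Wm * A * Vm) i j := by
    intro i j; fun_prop
  have hIntg : ∀ (X : ℝ → Matrix (Fin 2) (Fin 2) ℂ) (c : ℝ), 0 ≤ c → ContinuousOn X (Icc 0 c) →
      ∀ i j, (Wm * (∫ t in (0 : ℝ)..c, X t) * Vm) i j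
        = ∫ t in (0 : ℝ)..c, (Wm * X t * Vm) i j := by
    intro X c hc0 hX i j
    let L0 : Matrix (Fin 2) (Fin 2) ℂ →ₗ[ℂ] ℂ :=
      (Matrix.entryLinearMap ℂ ℂ i j) ∘ₗ (LinearMap.mulRight ℂ Vm) ∘ₗ (LinearMap.mulLeft ℂ Wm)
    let L : Matrix (Fin 2) (Fin 2) ℂ →L[ℂ] ℂ := LinearMap.toContinuousLinearMap L0
    have hi := ContinuousOn.intervalIntegrable (μ := MeasureTheory.volume) (u := X) (a := 0) (b := c)
      (by rwa [uIcc_of_le hc0])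
    have := L.intervalIntegral_comp_comm hi
    exact this.symm
  have hPp : Continuous Pplus := by unfold Pplus; fun_prop
  have hPm : Continuous Pminus := by unfold Pminus; fun_prop
  intro ξ₀ η₀ hm₀
  have hres := core b hb (fun t => Wm * (Bmat * Q t) * Vm)
    (fun t => Wm * (-((2⁻¹ : ℂ) • (Bmat * E₁ t))) * Vm)
    (fun t => Wm * (-((2⁻¹ : ℂ) • (Bmat * E₂ t))) * Vm)
    (⨆ x : Icc 0 b, ‖Q x‖) ((⨆ x : Icc 0 b, ‖E₁ x‖) / 2) ((⨆ x : Icc 0 b, ‖E₂ x‖) / 2)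
    (by fun_prop)
    (by
      intro x hx
      rw [conj_norm, B_norm]
      exact le_sup_Icc b Q hQ x hx)
    (by
      intro x hx
      rw [conj_norm, norm_neg, norm_smul, B_norm]
      have := le_sup_Icc b E₁ hE₁ x hx
      norm_num
      linarith)
    (by
      intro x hx
      rw [conj_norm, norm_neg, norm_smul, B_norm]
      have := le_sup_Icc b E₂ hE₂ x hx
      norm_num
      linarith)
    (by
      intro x j
      have h1 : Pplus (-((2⁻¹ : ℂ) • (Bmat * E₁ x))) = -((2⁻¹ : ℂ) • (Bmat * E₁ x)) := by
        have h2 : Bmat * (Bmat * E₁ x) * Bmat = Bmat * E₁ x := by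
          rw [← Matrix.mul_assoc, Bsq, Matrix.neg_mul, Matrix.one_mul, Matrix.neg_mul,
            hE₁anti, neg_neg]
        simp only [Pplus, Matrix.mul_neg, Matrix.neg_mul, Matrix.mul_smul, Matrix.smul_mul, h2]
        module
      have h3 := conj_Pplus (-((2⁻¹ : ℂ) • (Bmat * E₁ x))) j j
      rw [h1] at h3
      simpa only [if_true] using h3)
    (by
      intro x i j hij
      have h1 : Pminus (-((2⁻¹ : ℂ) • (Bmat * E₂ x))) = -((2⁻¹ : ℂ) • (Bmat * E₂ x)) := by
        have h2 : Bmat * (Bmat * E₂ x) * Bmat = -(Bmat * E₂ x) := by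
          rw [← Matrix.mul_assoc, Bsq, Matrix.neg_mul, Matrix.one_mul, Matrix.neg_mul,
            hE₂comm]
        simp only [Pminus, Matrix.mul_neg, Matrix.neg_mul, Matrix.mul_smul, Matrix.smul_mul, h2]
        module
      have h3 := conj_Pminus (-((2⁻¹ : ℂ) • (Bmat * E₂ x))) i j
      rw [h1, if_neg hij] at h3
      exact h3)
    (fun ξ η => Wm * H ξ η * Vm)
    (by fun_prop)
    (by
      intro ξ η hm i j
      obtain ⟨h1, h2, h3⟩ := id hm
      simp only at h1 h2 h3
      have hQ1 : ContinuousOn (fun u => Q (u + η)) (Icc 0 ξ) :=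
        hQ.comp (by fun_prop) (fun u hu => ⟨by linarith [hu.1], by linarith [hu.2]⟩)
      have hQ2 : ContinuousOn (fun v => Q (ξ + v)) (Icc 0 η) :=
        hQ.comp (by fun_prop) (fun u hu => ⟨by linarith [hu.1], by linarith [hu.2]⟩)
      have hH1 : ContinuousOn (fun u => H u η) (Icc 0 ξ) :=
        hHc.comp (f := fun u : ℝ => ((u, η) : ℝ × ℝ)) (by fun_prop)
          (fun u hu => ⟨hu.1, h2, by simp only; linarith [hu.2]⟩)
      have hH2 : ContinuousOn (fun v => H ξ v) (Icc 0 η) :=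
        hHc.comp (f := fun v : ℝ => ((ξ, v) : ℝ × ℝ)) (by fun_prop)
          (fun u hu => ⟨h1, hu.1, by simp only; linarith [hu.2]⟩)
      have e1 := hIntg (fun u => Bmat * Q (u + η) * Pplus (H u η)) ξ h1 (by
        have := hPp.comp_continuousOn hH1
        exact (continuousOn_const.mul hQ1).mul this) i j
      have e2 := hIntg (fun v => Bmat * Q (ξ + v) * Pminus (H ξ v)) η h2 (by
        have := hPm.comp_continuousOn hH2
        exact (continuousOn_const.mul hQ2).mul this) i j
      have e3 : ∀ X Y : Matrix (Fin 2) (Fin 2) ℂ, (Wm * (X * Pplus Y) * Vm) i j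
          = (Wm * X * Vm) i (1 - j) * (Wm * Y * Vm) (1 - j) j := by
        intro X Y
        rw [conjug_mul, Matrix.mul_apply, sum_twoC j, conj_Pplus, conj_Pplus, if_pos rfl,
          if_neg (ne_sub j), mul_zero, zero_add]
      have e4 : ∀ X Y : Matrix (Fin 2) (Fin 2) ℂ, (Wm * (X * Pminus Y) * Vm) i j
          = (Wm * X * Vm) i j * (Wm * Y * Vm) j j := by
        intro X Y
        rw [conjug_mul, Matrix.mul_apply, sum_twoC j, conj_Pminus, conj_Pminus, if_pos rfl,
          if_neg (ne_sub j), mul_zero, add_zero]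
      simp only [e3] at e1
      simp only [e4] at e2
      rw [← e1, ← e2]
      conv_lhs => rw [hHeq ξ η hm]
      rw [sub_eq_add_neg]
      simp only [Matrix.mul_add, Matrix.add_mul, Matrix.add_apply])
    ξ₀ η₀ hm₀
  rw [conj_norm] at hres
  rw [mul_comm b, add_div]
  exact hres
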